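/- In ℝ^d for any d ≥ 2 there exists a family (indexed by k → ∞) of solutions u to the interior impedance problem in the unit ball B^d with η = k and f = 0: Δu + k²u = 0 in B^d and ∂ₙu − ikγu = g on the unit sphere S^{d−1}, of the explicit form u(r,θ) = r^{1−d/2} J_ν(kr) φ(θ), where φ is a spherical harmonic on S^{d−1} with eigenvalue −μ², ν = (1/2)√((d−2)² + 4μ²), and g := (∂_r − ik)u|_{r=1}, such that k‖u‖_{L²(B^d)} ≥ c‖g‖_{L²(S^{d−1})} for some c > 0 independent of k. Consequently the estimate |k|‖u‖_{L²} ≲ ‖g‖_{L²(Γ)} for the interior impedance problem is sharp in its k-dependence. -/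

import Mathlib

open MeasureTheory Complex

noncomputable section

abbrev Euc (d : ℕ) := EuclideanSpace ℝ (Fin d)

/-- The Laplacian of a complex-valued function on `ℝ^d`. -/
def laplacianC {d : ℕ} (u : Euc d → ℂ) (x : Euc d) : ℂ :=
  ∑ i : Fin d, iteratedFDeriv ℝ 2 u x (fun _ => EuclideanSpace.single i (1 : ℝ))

/-- The Sommerfeld radiation condition with spectral parameter `lam`:
`∂u/∂r - i·lam·u = o(r^{-(d-1)/2})` uniformly as `r = |x| → ∞`. -/
def Sommerfeld {d : ℕ} (u : Euc d → ℂ) (lam : ℂ) : Prop :=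
  ∀ ε > (0 : ℝ), ∃ R > (0 : ℝ), ∀ x : Euc d, R ≤ ‖x‖ →
    ‖fderiv ℝ u x ((‖x‖ : ℝ)⁻¹ • x) - Complex.I * lam * u x‖ ≤
      ε * ‖x‖ ^ (-(((d : ℝ) - 1) / 2))

/-- The `L²(Ω)` norm of `u`. -/
def L2N {d : ℕ} (Ω : Set (Euc d)) (u : Euc d → ℂ) : ℝ :=
  (eLpNorm u 2 (volume.restrict Ω)).toReal

/-- The `L²(Ω)` norm of the gradient `∇u`. -/
def gradL2N {d : ℕ} (Ω : Set (Euc d)) (u : Euc d → ℂ) : ℝ :=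
  (eLpNorm (fun x => fderiv ℝ u x) 2 (volume.restrict Ω)).toReal

/-- Membership in `H¹_loc(Ω)`. -/
def MemH1loc {d : ℕ} (Ω : Set (Euc d)) (u : Euc d → ℂ) : Prop :=
  ∀ K : Set (Euc d), IsCompact K →
    MemLp u 2 (volume.restrict (Ω ∩ K)) ∧
    MemLp (fun x => fderiv ℝ u x) 2 (volume.restrict (Ω ∩ K))

/-- Membership in `H¹(Ω)`. -/
def MemH1 {d : ℕ} (Ω : Set (Euc d)) (u : Euc d → ℂ) : Prop :=
  MemLp u 2 (volume.restrict Ω) ∧ MemLp (fun x => fderiv ℝ u x) 2 (volume.restrict Ω)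

def psum (a : ℕ → ℝ) (t : ℝ) : ℝ := ∑' m, a m * t ^ m

lemma psum_summable (a : ℕ → ℝ) (ha : ∀ m, |a m| ≤ 1 / (m.factorial : ℝ)) (t : ℝ) :
    Summable fun m => a m * t ^ m := by
  refine Summable.of_norm_bounded (Real.summable_pow_div_factorial |t|) fun m => ?_
  rw [Real.norm_eq_abs, abs_mul, abs_pow, div_eq_mul_one_div, mul_comm]
  exact mul_le_mul_of_nonneg_left (ha m) (by positivity)

def shf (a : ℕ → ℝ) (m : ℕ) : ℝ := (m + 1) * a (m + 1)

lemma shf_bound (a : ℕ → ℝ) (ha : ∀ m, |a m| ≤ 1 / (m.factorial : ℝ)) (m : ℕ) :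
    |shf a m| ≤ 1 / (m.factorial : ℝ) := by
  have h := ha (m + 1)
  rw [shf, abs_mul, abs_of_nonneg (by positivity : (0:ℝ) ≤ (m:ℝ) + 1)]
  calc _ ≤ ((m:ℝ) + 1) * (1 / ((m+1).factorial : ℝ)) := by gcongr
    _ = _ := by
      rw [Nat.factorial_succ]; push_cast; field_simp

lemma psum_hasDerivAt (a : ℕ → ℝ) (ha : ∀ m, |a m| ≤ 1 / (m.factorial : ℝ)) (t : ℝ) :
    HasDerivAt (psum a) (psum (shf a) t) t := by
  have hs := psum_summable _ (shf_bound a ha)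
  set R := |t| + 1 with hR
  have hR0 : 0 ≤ R := by positivity
  have key := hasDerivAt_tsum_of_isPreconnected
    (u := fun m : ℕ => |a m * (m * R ^ (m - 1))|)
    (g := fun m t => a m * t ^ m) (g' := fun m t => a m * (m * t ^ (m - 1)))
    (t := Metric.ball (0:ℝ) R) (y₀ := t) (y := t) ?_ Metric.isOpen_ball
    (convex_ball _ _).isPreconnected ?_ ?_ ?_ (psum_summable a ha t) ?_
  · have h2 : ∑' m : ℕ, a m * (m * t ^ (m - 1)) = psum (shf a) t := by
      have hsm : Summable fun m : ℕ => a m * (m * t ^ (m - 1)) := by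
        rw [← summable_nat_add_iff 1]
        refine (hs t).congr fun m => ?_
        simp [shf]; ring
      rw [hsm.tsum_eq_zero_add]
      simp only [psum, shf]
      simp
      refine tsum_congr fun m => by ring
    rw [← h2]
    exact key
  · rw [← summable_nat_add_iff 1]
    refine ((hs R).abs).congr fun m => ?_
    simp [shf]; ring
  · intro m y _
    exact (hasDerivAt_pow m y).const_mul (a m)
  · intro m y hy
    have hy' : |y| ≤ R := by simpa using (Metric.mem_ball.1 hy).le
    simp only [Real.norm_eq_abs, abs_mul, abs_pow, abs_of_nonneg hR0]
    gcongr
  · simp [hR]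
  · simp [hR]

def bco (d : ℕ) : ℕ → ℝ
  | 0 => 1
  | m + 1 => - bco d m / (((m:ℝ) + 1) * (4 * m + 2 * d))

lemma bco_bound (d : ℕ) (hd : 2 ≤ d) (m : ℕ) : |bco d m| ≤ 1 / (m.factorial : ℝ) := by
  induction m with
  | zero => simp [bco]
  | succ m ih =>
    have hd' : (2:ℝ) ≤ d := by exact_mod_cast hd
    have hm : (0:ℝ) ≤ m := by positivity
    rw [bco, abs_div, abs_neg, abs_of_nonneg (by positivity : (0:ℝ) ≤ ((m:ℝ) + 1) * (4 * m + 2 * d)), Nat.factorial_succ, mul_comm ((m:ℝ)+1),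
      ← div_div]
    push_cast
    rw [mul_comm ((m:ℝ)+1), ← div_div]
    refine div_le_div_of_nonneg_right ?_ (by positivity)
    have h1 : (1:ℝ) ≤ 4 * m + 2 * d := by linarith
    exact (div_le_self (abs_nonneg _) h1).trans ih

def bF (d : ℕ) := psum (bco d)
def bG (d : ℕ) := psum (shf (bco d))
def bH (d : ℕ) := psum (shf (shf (bco d)))

lemma bF_deriv (d : ℕ) (hd : 2 ≤ d) (t : ℝ) : HasDerivAt (bF d) (bG d t) t :=
  psum_hasDerivAt _ (bco_bound d hd) t
lemma bG_deriv (d : ℕ) (hd : 2 ≤ d) (t : ℝ) : HasDerivAt (bG d) (bH d t) t :=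
  psum_hasDerivAt _ (shf_bound _ (bco_bound d hd)) t

lemma bF_zero (d : ℕ) : bF d 0 = 1 := by
  rw [bF, psum, tsum_eq_single 0]
  · simp [bco]
  · intro m hm; simp [hm]

lemma b_ode (d : ℕ) (hd : 2 ≤ d) (t : ℝ) :
    4 * t * bH d t + 2 * d * bG d t + bF d t = 0 := by
  have b0 := bco_bound d hd
  have b1 := shf_bound _ b0
  have b2 := shf_bound _ b1
  have s0 := psum_summable _ b0 t
  have s1 := psum_summable _ b1 t
  have s2 := psum_summable _ b2 t
  -- t * H = ∑ m * shf a m * t^m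
  have e : t * bH d t = ∑' m : ℕ, (m * shf (bco d) m) * t ^ m := by
    have hsm : Summable fun m : ℕ => (m * shf (bco d) m) * t ^ m := by
      rw [← summable_nat_add_iff 1]
      refine (s2.mul_left t).congr fun m => ?_
      simp only [shf]; push_cast; ring
    rw [hsm.tsum_eq_zero_add, bH, psum, ← tsum_mul_left]
    simp only [Nat.cast_zero, zero_mul, zero_add]
    refine tsum_congr fun m => ?_
    simp only [shf]; push_cast; ring
  have hsm : Summable fun m : ℕ => (m * shf (bco d) m) * t ^ m := by
    rw [← summable_nat_add_iff 1]
    refine (s2.mul_left t).congr fun m => ?_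
    simp only [shf]; push_cast; ring
  rw [mul_assoc, e, bG, bF, psum, psum, ← tsum_mul_left, ← tsum_mul_left,
    ← (hsm.mul_left 4).tsum_add (s1.mul_left _),
    ← ((hsm.mul_left 4).add (s1.mul_left _)).tsum_add s0]
  convert tsum_zero with m
  have hd' : (2:ℝ) ≤ d := by exact_mod_cast hd
  have hm : (0:ℝ) ≤ m := by positivity
  have : 4 * (m:ℝ) + 2 * d ≠ 0 := by positivity
  simp only [shf, bco]
  field_simp
  ring

lemma bessel_energy (d : ℕ) (hd : 2 ≤ d) (k : ℝ) :
    4 * k ^ 2 * bG d (k ^ 2) ^ 2 + bF d (k ^ 2) ^ 2 ≤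
      d * ∫ r in (0:ℝ)..1, r ^ (d - 1) * bF d (k ^ 2 * r ^ 2) ^ 2 := by
  have hd' : (2:ℝ) ≤ d := by exact_mod_cast hd
  have cF : Continuous (bF d) :=
    continuous_iff_continuousAt.2 fun t => (bF_deriv d hd t).continuousAt
  have cG : Continuous (bG d) :=
    continuous_iff_continuousAt.2 fun t => (bG_deriv d hd t).continuousAt
  have hE : ∀ r : ℝ, HasDerivAt
      (fun r => r ^ d * (4 * k ^ 2 * r ^ 2 * bG d (k ^ 2 * r ^ 2) ^ 2 + bF d (k ^ 2 * r ^ 2) ^ 2))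
      (r ^ (d - 1) * (d * bF d (k ^ 2 * r ^ 2) ^ 2
        + (2 - d) * (4 * k ^ 2 * r ^ 2 * bG d (k ^ 2 * r ^ 2) ^ 2))) r := by
    intro r
    have hq : HasDerivAt (fun r : ℝ => k ^ 2 * r ^ 2) (k ^ 2 * (2 * r)) r := by
      simpa using (hasDerivAt_pow 2 r).const_mul (k ^ 2)
    have hF := (bF_deriv d hd (k ^ 2 * r ^ 2)).comp r hq
    have hG := (bG_deriv d hd (k ^ 2 * r ^ 2)).comp r hq
    have h4 : HasDerivAt (fun r : ℝ => 4 * k ^ 2 * r ^ 2) (4 * k ^ 2 * (2 * r)) r := by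
      simpa using (hasDerivAt_pow 2 r).const_mul (4 * k ^ 2)
    have h := (hasDerivAt_pow d r).mul ((h4.mul (hG.pow 2)).add (hF.pow 2))
    have ode := b_ode d hd (k ^ 2 * r ^ 2)
    refine h.congr_deriv ?_
    simp only [Function.comp, Pi.pow_apply, Pi.mul_apply, Pi.add_apply]
    obtain ⟨n, rfl⟩ : ∃ n, d = n + 1 := ⟨d - 1, by omega⟩
    simp only [Nat.add_sub_cancel, pow_succ r n]
    push_cast at ode ⊢
    linear_combination (4 * r ^ n * r * k^2 * r * bG (n+1) (k ^ 2 * r ^ 2)) * ode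
  have hint := intervalIntegral.integral_eq_sub_of_hasDerivAt (a := 0) (b := 1)
    (fun r _ => hE r) (Continuous.intervalIntegrable (by fun_prop) _ _)
  have hd0 : d ≠ 0 := by omega
  simp only [one_pow, mul_one, one_mul, zero_pow hd0, zero_mul, sub_zero] at hint
  rw [← hint, ← intervalIntegral.integral_const_mul]
  refine intervalIntegral.integral_mono_on zero_le_one
    (Continuous.intervalIntegrable (by fun_prop) _ _)
    (Continuous.intervalIntegrable (by fun_prop) _ _) fun r hr => ?_
  have h1 : 0 ≤ r ^ (d - 1) := pow_nonneg hr.1 _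
  have h2 : 0 ≤ 4 * k ^ 2 * r ^ 2 * bG d (k ^ 2 * r ^ 2) ^ 2 := by positivity
  nlinarith [mul_nonneg h1 (mul_nonneg (sub_nonneg.2 hd') h2)]

def uR (d : ℕ) (k : ℝ) (x : Euc d) : ℂ := ((bF d (k ^ 2 * ‖x‖ ^ 2) : ℝ) : ℂ)

lemma normsq_hasFDerivAt {d : ℕ} (k : ℝ) (x : Euc d) :
    HasFDerivAt (fun x : Euc d => k ^ 2 * ‖x‖ ^ 2) ((2 * k ^ 2) • innerSL ℝ x) x := by
  have h := ((hasStrictFDerivAt_norm_sq x).hasFDerivAt).const_mul (k ^ 2)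
  refine h.congr_fderiv ?_
  ext v
  simp
  ring

lemma uR_hasFDerivAt (d : ℕ) (hd : 2 ≤ d) (k : ℝ) (x : Euc d) :
    HasFDerivAt (uR d k)
      (Complex.ofRealCLM.comp ((bG d (k ^ 2 * ‖x‖ ^ 2) * (2 * k ^ 2)) • innerSL ℝ x)) x := by
  have h := Complex.ofRealCLM.hasFDerivAt.comp x
    ((bF_deriv d hd (k ^ 2 * ‖x‖ ^ 2)).comp_hasFDerivAt x (normsq_hasFDerivAt k x))
  rw [smul_smul] at h
  exact h

lemma uR_second (d : ℕ) (hd : 2 ≤ d) (k : ℝ) (x v : Euc d) :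
    iteratedFDeriv ℝ 2 (uR d k) x (fun _ => v) =
      ((bH d (k ^ 2 * ‖x‖ ^ 2) * (4 * k ^ 4) * (inner ℝ x v) ^ 2
        + bG d (k ^ 2 * ‖x‖ ^ 2) * (2 * k ^ 2) * ‖v‖ ^ 2 : ℝ) : ℂ) := by
  rw [iteratedFDeriv_two_apply]
  have h1 : fderiv ℝ (uR d k) = fun x => (Complex.ofRealCLM.comp
      ((bG d (k ^ 2 * ‖x‖ ^ 2) * (2 * k ^ 2)) • innerSL ℝ x)) := by
    ext1 y; exact (uR_hasFDerivAt d hd k y).fderiv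
  have hg : HasFDerivAt (fun x : Euc d => bG d (k ^ 2 * ‖x‖ ^ 2) * (2 * k ^ 2))
      _ x := ((bG_deriv d hd (k ^ 2 * ‖x‖ ^ 2)).comp_hasFDerivAt x
        (normsq_hasFDerivAt k x)).mul_const (2 * k ^ 2)
  have hi : HasFDerivAt (fun x : Euc d => innerSL ℝ x) (innerSL ℝ) x :=
    (innerSL ℝ (E := Euc d)).hasFDerivAt
  have h2 := (ContinuousLinearMap.hasFDerivAt
    (ContinuousLinearMap.compL ℝ (Euc d) ℝ ℂ Complex.ofRealCLM)
    (x := (bG d (k ^ 2 * ‖x‖ ^ 2) * (2 * k ^ 2)) • innerSL ℝ x)).comp x (hg.smul hi)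
  change HasFDerivAt (fun x => (Complex.ofRealCLM.comp
      ((bG d (k ^ 2 * ‖x‖ ^ 2) * (2 * k ^ 2)) • innerSL ℝ x))) _ x at h2
  rw [← h1] at h2
  rw [h2.fderiv]
  have hvv : (innerSL ℝ v) v = ‖v‖ ^ 2 := by
    rw [innerSL_apply_apply, real_inner_self_eq_norm_sq]
  simp
  erw [hvv]
  push_cast
  ring

lemma uR_laplacian (d : ℕ) (hd : 2 ≤ d) (k : ℝ) (x : Euc d) :
    laplacianC (uR d k) x + (k : ℂ) ^ 2 * uR d k x = 0 := by
  have hs : ∑ i : Fin d, (inner ℝ x (EuclideanSpace.single i (1:ℝ))) ^ 2 = ‖x‖ ^ 2 := by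
    rw [EuclideanSpace.norm_sq_eq]
    simp [EuclideanSpace.inner_single_right]
  have ode := b_ode d hd (k ^ 2 * ‖x‖ ^ 2)
  simp only [laplacianC, uR_second d hd]
  rw [uR, ← Complex.ofReal_sum, Finset.sum_add_distrib, ← Finset.mul_sum, hs]
  norm_cast
  simp
  linear_combination k ^ 2 * ode

lemma g_norm (d : ℕ) (C : ℂ) :
    (eLpNorm (fun _ : Metric.sphere (0 : Euc d) 1 => C) 2
      (volume : Measure (Euc d)).toSphere).toReal ^ 2
      = ‖C‖ ^ 2 * (d * (volume : Measure (Euc d)).real (Metric.ball 0 1)) := by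
  rw [eLpNorm_const' C (by simp) (by simp), ENNReal.toReal_mul, mul_pow, ← ENNReal.toReal_rpow]
  have h := Measure.toSphere_real_apply_univ (volume : Measure (Euc d))
  rw [finrank_euclideanSpace_fin] at h
  rw [← measureReal_def, h, show (1:ℝ) / (2:ENNReal).toReal = 1/2 by simp, ← Real.sqrt_eq_rpow, Real.sq_sqrt (by positivity)]
  simp

lemma u_norm (d : ℕ) (hd : 2 ≤ d) (k : ℝ) :
    (eLpNorm (uR d k) 2 (volume.restrict (Metric.ball (0 : Euc d) 1))).toReal ^ 2
      = (d * (volume : Measure (Euc d)).real (Metric.ball 0 1)) *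
        ∫ r in (0:ℝ)..1, r ^ (d - 1) * bF d (k ^ 2 * r ^ 2) ^ 2 := by
  have cF : Continuous (bF d) :=
    continuous_iff_continuousAt.2 fun t => (bF_deriv d hd t).continuousAt
  have cu : Continuous (uR d k) :=
    continuous_iff_continuousAt.2 fun t => (uR_hasFDerivAt d hd k t).continuousAt
  have hmem : MemLp (uR d k) 2 (volume.restrict (Metric.ball (0 : Euc d) 1)) := by
    obtain ⟨C, hC⟩ := (isCompact_closedBall (0 : Euc d) 1).exists_bound_of_continuousOn
      cu.continuousOn
    have : IsFiniteMeasure (volume.restrict (Metric.ball (0 : Euc d) 1)) :=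
      ⟨by simpa using measure_ball_lt_top⟩
    refine MemLp.of_bound cu.aestronglyMeasurable C ?_
    filter_upwards [ae_restrict_mem Metric.isOpen_ball.measurableSet] with x hx
    exact hC x (Metric.ball_subset_closedBall hx)
  rw [hmem.eLpNorm_eq_integral_rpow_norm (by simp) (by simp), ENNReal.toReal_ofReal (by positivity)]
  have e : ((2:ENNReal).toReal)⁻¹ = 1 / 2 := by simp
  rw [e, ← Real.sqrt_eq_rpow, Real.sq_sqrt (by positivity)]
  rw [← integral_indicator Metric.isOpen_ball.measurableSet]
  have : Nontrivial (Euc d) := by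
    have : 0 < d := by omega
    have : Nonempty (Fin d) := ⟨⟨0, this⟩⟩
    infer_instance
  have h := integral_fun_norm_addHaar (volume : Measure (Euc d))
    ((Set.Iio (1:ℝ)).indicator fun r => bF d (k ^ 2 * r ^ 2) ^ 2)
  rw [finrank_euclideanSpace_fin] at h
  have e1 : (Metric.ball (0 : Euc d) 1).indicator (fun x => ‖uR d k x‖ ^ (2:ENNReal).toReal)
      = fun x => ((Set.Iio (1:ℝ)).indicator fun r => bF d (k ^ 2 * r ^ 2) ^ 2) ‖x‖ := by
    ext x
    simp [Set.indicator, uR]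
  rw [e1, h]
  simp only [smul_eq_mul, nsmul_eq_mul]
  rw [mul_assoc]
  congr 2
  rw [intervalIntegral.integral_of_le zero_le_one, integral_Ioc_eq_integral_Ioo,
    ← integral_indicator measurableSet_Ioi, ← integral_indicator measurableSet_Ioo]
  congr 1
  ext r
  by_cases h0 : 0 < r <;> by_cases h1 : r < 1 <;> simp [Set.indicator, h0, h1]

/-- **Lemma (Sharpness of the interior impedance estimate on the unit ball).**
In `ℝ^d`, `d ≥ 2`, there is a family (indexed by `k → ∞`) of solutions `u` of the
interior impedance problem in the unit ball `B^d` with `η = k` and `f = 0`: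
`Δu + k²u = 0` in `B^d`, `∂ₙu − ikγu = g` on `S^{d-1}`, of the explicit form
`u(r,θ) = r^{1-d/2} J_ν(kr) φ(θ)` — here `φ = P|_{S^{d-1}}` with `P` a nonzero
harmonic polynomial homogeneous of degree `l` (a spherical harmonic with eigenvalue
`-μ² = -l(l+d-2)`), `ν = l + (d-2)/2 = (1/2)√((d-2)² + 4μ²)`, and `J_ν` is the Bessel
function of the first kind, encoded as the solution of the Bessel ODE of order `ν`
that is continuous up to `0` — with `g := (∂_r − ik)u|_{r=1}`, such that
`k‖u‖_{L²(B^d)} ≥ c‖g‖_{L²(S^{d-1})}` with `c > 0` independent of `k`.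
Consequently the bound `|k|‖u‖_{L²(Ω)} ≲ ‖g‖_{L²(Γ)}` is sharp in its `k`-dependence. -/
theorem interior_impedance_sharpness (d : ℕ) (hd : 2 ≤ d) :
    ∃ c : ℝ, 0 < c ∧ ∃ l : ℕ, ∃ K : ℝ, ∀ k : ℝ, K ≤ k →
      ∃ (P : Euc d → ℂ) (J : ℝ → ℝ) (u : Euc d → ℂ)
        (g : Metric.sphere (0 : Euc d) 1 → ℂ),
        -- `P` is a nonzero harmonic polynomial, homogeneous of degree `l`
        P ≠ 0 ∧
        (∀ x : Euc d, laplacianC P x = 0) ∧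
        (∀ c' : ℝ, 0 ≤ c' → ∀ x : Euc d, P (c' • x) = (c' : ℂ) ^ l * P x) ∧
        -- `J` is the Bessel function `J_ν` with `ν = l + (d-2)/2`: a solution of the
        -- Bessel ODE on `(0,∞)` that is continuous up to `0`, and not identically `0`
        ContinuousOn J (Set.Ici (0 : ℝ)) ∧ (∃ x > (0:ℝ), J x ≠ 0) ∧
        (∀ x ∈ Set.Ioi (0 : ℝ), DifferentiableAt ℝ J x ∧ DifferentiableAt ℝ (deriv J) x) ∧
        (∀ x ∈ Set.Ioi (0 : ℝ),
          x ^ 2 * deriv (deriv J) x + x * deriv J x +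
            (x ^ 2 - ((l : ℝ) + ((d : ℝ) - 2) / 2) ^ 2) * J x = 0) ∧
        -- the explicit form `u(r,θ) = r^{1-d/2} J_ν(kr) φ(θ)`
        (∀ x : Euc d, x ≠ 0 → u x =
          ((‖x‖ ^ ((1 : ℝ) - (d : ℝ) / 2) : ℝ) : ℂ) * (J (k * ‖x‖) : ℂ) *
            P ((‖x‖)⁻¹ • x)) ∧
        -- `u` solves the Helmholtz equation in the unit ball
        (∀ x ∈ Metric.ball (0 : Euc d) 1, laplacianC u x + (k : ℂ) ^ 2 * u x = 0) ∧
        -- the impedance boundary data `g = (∂_r − ik)u|_{r=1}`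
        (∀ θ : Metric.sphere (0 : Euc d) 1,
          g θ = fderiv ℝ u (θ : Euc d) (θ : Euc d) - Complex.I * (k : ℂ) * u (θ : Euc d)) ∧
        -- the sharpness inequality `k‖u‖_{L²(B^d)} ≥ c‖g‖_{L²(S^{d-1})}`
        c * (eLpNorm g 2 (volume : Measure (Euc d)).toSphere).toReal ≤
          k * (eLpNorm u 2 (volume.restrict (Metric.ball (0 : Euc d) 1))).toReal := by
  have hd' : (2:ℝ) ≤ d := by exact_mod_cast hd
  refine ⟨(√(d:ℝ))⁻¹, by positivity, 0, 1, fun k hk => ?_⟩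
  have hk0 : 0 < k := by linarith
  set α : ℝ := (d:ℝ) / 2 - 1 with hα
  have hα0 : 0 ≤ α := by rw [hα]; linarith
  have cF : Continuous (bF d) :=
    continuous_iff_continuousAt.2 fun t => (bF_deriv d hd t).continuousAt
  have hsq : ∀ s : ℝ, HasDerivAt (fun s : ℝ => s ^ 2) (2 * s) s := fun s => by
    simpa using hasDerivAt_pow 2 s
  have hJ1 : ∀ s : ℝ, 0 < s → HasDerivAt (fun s => k ^ (-α) * (s ^ α * bF d (s ^ 2)))
      (k ^ (-α) * (α * s ^ (α - 1) * bF d (s ^ 2) + s ^ α * (bG d (s ^ 2) * (2 * s)))) s := by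
    intro s hs
    exact ((Real.hasDerivAt_rpow_const (Or.inl hs.ne')).mul
      ((bF_deriv d hd (s ^ 2)).comp s (hsq s))).const_mul _
  have hJ2 : ∀ s : ℝ, 0 < s → HasDerivAt (deriv (fun s => k ^ (-α) * (s ^ α * bF d (s ^ 2))))
      (k ^ (-α) * ((α * ((α - 1) * s ^ (α - 1 - 1)) * bF d (s ^ 2)
        + α * s ^ (α - 1) * (bG d (s ^ 2) * (2 * s)))
        + (α * s ^ (α - 1) * (bG d (s ^ 2) * (2 * s))
          + s ^ α * ((bH d (s ^ 2) * (2 * s)) * (2 * s) + bG d (s ^ 2) * 2)))) s := by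
    intro s hs
    have h2 : HasDerivAt (fun s : ℝ => 2 * s) 2 s := by
      simpa using (hasDerivAt_id s).const_mul 2
    have h := ((((Real.hasDerivAt_rpow_const (p := α - 1) (Or.inl hs.ne')).const_mul α).mul
      ((bF_deriv d hd (s ^ 2)).comp s (hsq s))).add
      ((Real.hasDerivAt_rpow_const (p := α) (Or.inl hs.ne')).mul
        (((bG_deriv d hd (s ^ 2)).comp s (hsq s)).mul h2))).const_mul (k ^ (-α))
    refine h.congr_of_eventuallyEq ?_
    filter_upwards [lt_mem_nhds hs] with y hy
    exact (hJ1 y hy).deriv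
  refine ⟨fun _ => 1, fun s => k ^ (-α) * (s ^ α * bF d (s ^ 2)), uR d k,
    fun θ => fderiv ℝ (uR d k) (θ : Euc d) (θ : Euc d) - Complex.I * (k : ℂ) * uR d k (θ : Euc d),
    ?_, ?_, ?_, ?_, ?_, ?_, ?_, ?_, ?_, ?_, ?_⟩
  · intro h
    have := congrFun h 0
    simp at this
  · intro x
    simp [laplacianC, iteratedFDeriv_const_of_ne]
  · intro c' _ x
    simp
  · refine Continuous.continuousOn ?_
    exact continuous_const.mul ((Real.continuous_rpow_const hα0).mul (cF.comp (continuous_pow 2)))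
  · have h1 : ∀ᶠ s : ℝ in nhdsWithin 0 (Set.Ioi 0), bF d (s ^ 2) ≠ 0 := by
      refine nhdsWithin_le_nhds ?_
      have hc : ContinuousAt (fun s : ℝ => bF d (s ^ 2)) 0 :=
        (cF.comp (continuous_pow 2)).continuousAt
      exact hc.eventually_ne (by simp [bF_zero])
    obtain ⟨s, hs, hs0⟩ := (h1.and self_mem_nhdsWithin).exists
    have hs0' : 0 < s := hs0
    exact ⟨s, hs0, mul_ne_zero (by positivity) (mul_ne_zero (by positivity) hs)⟩
  · intro s hs
    exact ⟨(hJ1 s hs).differentiableAt, (hJ2 s hs).differentiableAt⟩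
  · intro s hs
    have hs' : 0 < s := hs
    rw [(hJ1 s hs).deriv, (hJ2 s hs).deriv]
    have ode := b_ode d hd (s ^ 2)
    have e1 : s ^ (α - 1) = s ^ α / s := by rw [Real.rpow_sub hs', Real.rpow_one]
    have e2 : s ^ (α - 1 - 1) = s ^ α / s / s := by
      rw [Real.rpow_sub hs', Real.rpow_one, e1]
    rw [e1, e2]
    have hdα : (d:ℝ) = 2 * α + 2 := by rw [hα]; ring
    rw [hdα] at ode ⊢
    push_cast
    field_simp
    linear_combination ((k ^ (-α)) * s ^ α * s ^ 2) * ode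
  · intro x hx
    have hx0 : 0 < ‖x‖ := norm_pos_iff.2 hx
    rw [uR]
    have e0 : (1:ℝ) - (d:ℝ) / 2 = -α := by rw [hα]; ring
    rw [e0, mul_one, ← Complex.ofReal_mul]
    congr 1
    beta_reduce
    rw [Real.mul_rpow hk0.le hx0.le, Real.rpow_neg hk0.le, Real.rpow_neg hx0.le, mul_pow]
    have p1 : k ^ α ≠ 0 := by positivity
    have p2 : ‖x‖ ^ α ≠ 0 := by positivity
    field_simp
  · intro x _
    exact uR_laplacian d hd k x
  · intro θ
    rfl
  · have hg : (fun θ : Metric.sphere (0 : Euc d) 1 => fderiv ℝ (uR d k) (θ : Euc d) (θ : Euc d)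
        - Complex.I * (k : ℂ) * uR d k (θ : Euc d)) =
        fun _ => ((2 * k ^ 2 * bG d (k ^ 2) : ℝ) : ℂ)
          + ((-(k * bF d (k ^ 2)) : ℝ) : ℂ) * Complex.I := by
      ext θ
      rw [(uR_hasFDerivAt d hd k _).fderiv]
      have hθ : ‖(θ : Euc d)‖ = 1 := by simp
      simp [uR, hθ]
      ring
    rw [hg]
    have hG := g_norm d (((2 * k ^ 2 * bG d (k ^ 2) : ℝ) : ℂ)
          + ((-(k * bF d (k ^ 2)) : ℝ) : ℂ) * Complex.I)
    rw [← Complex.normSq_eq_norm_sq, Complex.normSq_add_mul_I] at hG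
    have hU := u_norm d hd k
    refine (abs_le_of_sq_le_sq' ?_ (by positivity)).2
    rw [mul_pow, mul_pow, hG, hU, inv_pow, Real.sq_sqrt (by positivity)]
    have hE := bessel_energy d hd k
    set I := ∫ r in (0:ℝ)..1, r ^ (d - 1) * bF d (k ^ 2 * r ^ 2) ^ 2
    set V := (volume : Measure (Euc d)).real (Metric.ball 0 1)
    have hV : 0 ≤ V := by positivity
    have hdp : (0:ℝ) < d := by linarith
    have := mul_le_mul_of_nonneg_left hE (by positivity : 0 ≤ V * k ^ 2)
    calc _ = V * k ^ 2 * (4 * k ^ 2 * bG d (k ^ 2) ^ 2 + bF d (k ^ 2) ^ 2) := by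
          field_simp; ring
      _ ≤ _ := this
      _ = _ := by ring
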